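/- Let P ⊂ ℝ^n be a rational polytope with 0 ∈ P and let d := den(P^∨). Then for every integer i with 0 ≤ i ≤ d − 1, (lenv(cone P) + (i/d)e_{n+1}) ∩ ℤ^{n+1} = ((cone P + (i/d)e_{n+1}) ∩ ℤ^{n+1}) \ ((cone P + ((i+1)/d)e_{n+1}) ∩ ℤ^{n+1}). -/

import Mathlib

open Set Pointwise
open scoped Classical

noncomputable section

namespace ArxivFreeSum

/-- A point of `ℝ^m` is an integer lattice point iff all coordinates are integers. -/
def IsLat {m : ℕ} (x : Fin m → ℝ) : Prop := ∀ i, ∃ z : ℤ, x i = (z : ℝ)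

/-- The set of integer lattice points of a set `S`. -/
def latt {m : ℕ} (S : Set (Fin m → ℝ)) : Set (Fin m → ℝ) := {x | x ∈ S ∧ IsLat x}

variable {n : ℕ}

/-- The affine embedding `α : ℝ^n → ℝ^{n+1}`, `a ↦ (a, 1)`. -/
def emb (a : Fin n → ℝ) : Fin (n + 1) → ℝ := Fin.snoc a 1

/-- The cone over `K`: all nonnegative multiples of `α(K)`. -/
def cone (K : Set (Fin n → ℝ)) : Set (Fin (n + 1) → ℝ) :=
  {x | ∃ l : ℝ, ∃ a ∈ K, 0 ≤ l ∧ x = l • emb a}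

/-- The last standard basis vector `e_{n+1}` of `ℝ^{n+1}`. -/
def eLast (n : ℕ) : Fin (n + 1) → ℝ := Pi.single (Fin.last n) 1

/-- The vertical projection `ε_J` onto the lower envelope of `cone J`. -/
def eps (J : Set (Fin n → ℝ)) (x : Fin (n + 1) → ℝ) : Fin (n + 1) → ℝ :=
  x - sSup {l : ℝ | x - l • eLast n ∈ cone J} • eLast n

/-- The lower envelope of `cone J`. -/
def lenv (J : Set (Fin n → ℝ)) : Set (Fin (n + 1) → ℝ) := eps J '' cone J

/-- The lower lattice envelope of `cone J`. -/
def llenv (J : Set (Fin n → ℝ)) : Set (Fin (n + 1) → ℝ) := eps J '' latt (cone J)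

/-- `J ⊕ K` is a free sum. -/
def IsFreeSum (J K : Set (Fin n → ℝ)) : Prop :=
  (0 : Fin n → ℝ) ∈ J ∧ (0 : Fin n → ℝ) ∈ K ∧
    ∀ m : Fin n → ℝ, m ∈ Submodule.span ℝ (J ∪ K) → IsLat m →
      ∃! q : (Fin n → ℝ) × (Fin n → ℝ),
        (q.1 ∈ Submodule.span ℝ J ∧ IsLat q.1) ∧
        (q.2 ∈ Submodule.span ℝ K ∧ IsLat q.2) ∧ m = q.1 + q.2

/-- `N_{J,K}(m)`: the number of pairs of lattice points of `cone J` and `cone K` summing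
to `m`. -/
def Npairs (J K : Set (Fin n → ℝ)) (m : Fin (n + 1) → ℤ) : ℕ :=
  Set.ncard {q : (Fin (n + 1) → ℝ) × (Fin (n + 1) → ℝ) |
    q.1 ∈ latt (cone J) ∧ q.2 ∈ latt (cone K) ∧ q.1 + q.2 = fun i => (m i : ℝ)}

/-- The coefficientwise form of the multivariate Braun equation
`σ_{cone(J⊕K)} = (1 - z_{n+1}) σ_{cone J} σ_{cone K}`. -/
def BraunEq (J K : Set (Fin n → ℝ)) : Prop :=
  ∀ m : Fin (n + 1) → ℤ,
    (Npairs J K m : ℤ) - (Npairs J K (m - Pi.single (Fin.last n) 1) : ℤ) =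
      if (fun i => (m i : ℝ)) ∈ cone (convexHull ℝ (J ∪ K)) then 1 else 0

/-- A rational polytope: convex hull of finitely many rational points. -/
def IsRatPolytope (P : Set (Fin n → ℝ)) : Prop :=
  ∃ V : Finset (Fin n → ℝ), (∀ v ∈ V, ∀ i, ∃ q : ℚ, v i = (q : ℝ)) ∧
    P = convexHull ℝ (V : Set (Fin n → ℝ))

/-- A lattice polytope: convex hull of finitely many lattice points. -/
def IsLatPolytope (P : Set (Fin n → ℝ)) : Prop :=
  ∃ V : Finset (Fin n → ℝ), (∀ v ∈ V, IsLat v) ∧ P = convexHull ℝ (V : Set (Fin n → ℝ))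

/-- The polar dual `P^∨ ⊆ (lin P)^*` of a polytope `P` containing the origin. -/
def dualSet (P : Set (Fin n → ℝ)) : Set (Module.Dual ℝ (Submodule.span ℝ P)) :=
  {φ | ∀ a : Submodule.span ℝ P, (a : Fin n → ℝ) ∈ P → φ a ≤ 1}

/-- Membership in the dual integer lattice `(lin P)^*_ℤ`. -/
def IsDualLatticePt (P : Set (Fin n → ℝ)) (φ : Module.Dual ℝ (Submodule.span ℝ P)) : Prop :=
  ∀ a : Submodule.span ℝ P, IsLat (a : Fin n → ℝ) → ∃ z : ℤ, φ a = (z : ℝ)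

/-- `P^∨` is a lattice polyhedron: every vertex (= extreme point) of `P^∨` lies in the
dual integer lattice. -/
def DualIsLatticePolyhedron (P : Set (Fin n → ℝ)) : Prop :=
  ∀ φ ∈ Set.extremePoints ℝ (dualSet P), IsDualLatticePt P φ

/-- `den(P^∨)`: the smallest positive integer `d` such that `d • P^∨` is a lattice
polyhedron. -/
def dualDen (P : Set (Fin n → ℝ)) : ℕ :=
  sInf {d : ℕ | 0 < d ∧ ∀ φ ∈ Set.extremePoints ℝ (dualSet P), IsDualLatticePt P ((d : ℝ) • φ)}

/-- `L_P(k)`, with `L_P(0) = 1`. -/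
def ehr (P : Set (Fin n → ℝ)) (k : ℕ) : ℕ :=
  if k = 0 then 1 else Set.ncard (latt ((k : ℝ) • P))

/-- The coefficientwise form of `Ehr_{P⊕Q}(t) = (1-t) Ehr_P(t) Ehr_Q(t)`. -/
def EhrEq (P Q : Set (Fin n → ℝ)) : Prop :=
  ∀ k : ℕ,
    (ehr (convexHull ℝ (P ∪ Q)) k : ℤ) =
      (∑ i ∈ Finset.range (k + 1), (ehr P i : ℤ) * (ehr Q (k - i) : ℤ)) -
        ∑ i ∈ Finset.range k, (ehr P i : ℤ) * (ehr Q (k - 1 - i) : ℤ)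

/-- `P` is reflexive: a lattice polytope containing the origin in its relative interior
whose polar dual is a lattice polytope. -/
def IsReflexive (P : Set (Fin n → ℝ)) : Prop :=
  IsLatPolytope P ∧ (0 : Fin n → ℝ) ∈ intrinsicInterior ℝ P ∧ DualIsLatticePolyhedron P

/-- `P` is Gorenstein of index `k`. -/
def IsGorenstein (P : Set (Fin n → ℝ)) (k : ℕ) : Prop :=
  IsLatPolytope P ∧ 0 < k ∧
    ∃ m : Fin n → ℝ, IsLat m ∧ IsReflexive ((fun x => x - m) '' ((k : ℝ) • P))

/-- `p` is a rational point. -/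
def IsRatPt (p : Fin n → ℝ) : Prop := ∀ i, ∃ q : ℚ, p i = (q : ℝ)

/-- Membership in the lattice `Λ^p` generated by `e_1, …, e_n` and `p`. -/
def InLambda (p x : Fin n → ℝ) : Prop :=
  ∃ (z : Fin n → ℤ) (c : ℤ), x = (fun i => (z i : ℝ)) + (c : ℝ) • p

/-- `den(p)`: the lcm of the denominators of the coordinates of `p`, i.e. the least
positive integer `r` with `r • p` a lattice point. -/
def denPt (p : Fin n → ℝ) : ℕ := sInf {r : ℕ | 0 < r ∧ IsLat ((r : ℝ) • p)}

/-- The projection `ε^p_J` parallel to `α(p)` onto the `p`-lower envelope of `cone J`. -/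
def epsP (p : Fin n → ℝ) (J : Set (Fin n → ℝ)) (x : Fin (n + 1) → ℝ) : Fin (n + 1) → ℝ :=
  x - sSup {l : ℝ | x - l • emb p ∈ cone J} • emb p

/-- The `p`-lower envelope of `cone J`. -/
def plenv (p : Fin n → ℝ) (J : Set (Fin n → ℝ)) : Set (Fin (n + 1) → ℝ) := epsP p J '' cone J

/-- The `p`-lower lattice envelope of `cone J`. -/
def pllenv (p : Fin n → ℝ) (J : Set (Fin n → ℝ)) : Set (Fin (n + 1) → ℝ) :=
  epsP p J '' latt (cone J)

/-- `J ⊕ K` is an affine free sum with common (rational) point `p`. -/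
def IsAffineFreeSum (J K : Set (Fin n → ℝ)) (p : Fin n → ℝ) : Prop :=
  IsRatPt p ∧ p ∈ J ∧ p ∈ K ∧
    ((affineSpan ℝ J : Set (Fin n → ℝ)) ∩ (affineSpan ℝ K : Set (Fin n → ℝ)) = {p}) ∧
    ∀ m : Fin n → ℝ, m ∈ Submodule.span ℝ ((fun x => x - p) '' (J ∪ K)) → InLambda p m →
      ∃! q : (Fin n → ℝ) × (Fin n → ℝ),
        (q.1 ∈ Submodule.span ℝ ((fun x => x - p) '' J) ∧ InLambda p q.1) ∧
        (q.2 ∈ Submodule.span ℝ ((fun x => x - p) '' K) ∧ InLambda p q.2) ∧ m = q.1 + q.2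


/-- Coordinate form of membership in the cone. -/
def CC {n : ℕ} (P : Set (Fin n → ℝ)) (m : Fin n → ℝ) (t : ℝ) : Prop :=
  0 ≤ t ∧ ∃ a ∈ P, m = t • a

lemma mem_cone_iff {n : ℕ} (P : Set (Fin n → ℝ)) (x : Fin (n + 1) → ℝ) :
    x ∈ cone P ↔ CC P (fun j => x j.castSucc) (x (Fin.last n)) := by
  constructor
  · rintro ⟨l, a, ha, hl, rfl⟩
    have h1 : (l • emb a) (Fin.last n) = l := by simp [emb]
    refine ⟨by rw [h1]; exact hl, a, ha, ?_⟩
    rw [h1]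
    ext j
    simp [emb]
  · rintro ⟨hl, a, ha, h⟩
    refine ⟨x (Fin.last n), a, ha, hl, ?_⟩
    ext j
    refine Fin.lastCases ?_ (fun j => ?_) j
    · simp [emb]
    · simpa [emb] using congrFun h j

lemma sub_mem_cone_iff {n : ℕ} (P : Set (Fin n → ℝ)) (x : Fin (n + 1) → ℝ) (l : ℝ) :
    x - l • eLast n ∈ cone P ↔ CC P (fun j => x j.castSucc) (x (Fin.last n) - l) := by
  rw [mem_cone_iff]
  simp [eLast]

lemma CC_mono {n : ℕ} {P : Set (Fin n → ℝ)} (hc : Convex ℝ P) (h0 : (0 : Fin n → ℝ) ∈ P)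
    {m : Fin n → ℝ} {s t : ℝ} (h : CC P m s) (hst : s ≤ t) : CC P m t := by
  obtain ⟨hs, a, ha, rfl⟩ := h
  refine ⟨hs.trans hst, ?_⟩
  rcases eq_or_lt_of_le (hs.trans hst) with h | h
  · refine ⟨a, ha, ?_⟩
    have : s = t := by linarith
    rw [this]
  · refine ⟨(s / t) • a, ?_, ?_⟩
    · exact hc.smul_mem_of_zero_mem h0 ha ⟨by positivity, (div_le_one h).2 hst⟩
    · rw [smul_smul]; congr 1; field_simp

lemma CC_mem_span {n : ℕ} {P : Set (Fin n → ℝ)} {m : Fin n → ℝ} {s : ℝ} (h : CC P m s) :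
    m ∈ Submodule.span ℝ P := by
  obtain ⟨_, a, ha, rfl⟩ := h
  exact Submodule.smul_mem _ _ (Submodule.subset_span ha)

lemma CC_le {n : ℕ} {P : Set (Fin n → ℝ)} {m : Fin n → ℝ} {s : ℝ} (h : CC P m s)
    {φ : Module.Dual ℝ (Submodule.span ℝ P)} (hφ : φ ∈ dualSet P)
    (hm : m ∈ Submodule.span ℝ P) : φ ⟨m, hm⟩ ≤ s := by
  obtain ⟨hs, a, ha, rfl⟩ := h
  have : (⟨s • a, hm⟩ : Submodule.span ℝ P) = s • ⟨a, Submodule.subset_span ha⟩ := rfl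
  rw [this, map_smul, smul_eq_mul]
  have := hφ ⟨a, Submodule.subset_span ha⟩ ha
  nlinarith

lemma sep {n : ℕ} {P : Set (Fin n → ℝ)} (hc : Convex ℝ P) (hk : IsCompact P)
    (h0 : (0 : Fin n → ℝ) ∈ P) {m : Fin n → ℝ} {t : ℝ} (ht : ¬ CC P m t)
    (hm : m ∈ Submodule.span ℝ P) :
    ∃ φ ∈ dualSet P, t < φ ⟨m, hm⟩ := by
  rcases lt_trichotomy t 0 with h | h | h
  · exact ⟨0, fun a _ => by simp, by simpa using h⟩
  · subst h
    have hm0 : m ≠ 0 := by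
      rintro rfl
      exact ht ⟨le_refl _, 0, h0, by simp⟩
    obtain ⟨f, u, v, hf, huv, hv⟩ := geometric_hahn_banach_compact_closed
      (convex_singleton (𝕜 := ℝ) (0 : Fin n → ℝ)) isCompact_singleton
      (convex_singleton (𝕜 := ℝ) m) isClosed_singleton (by simpa using hm0.symm)
    have h1 := hf 0 rfl
    have h2 := hv m rfl
    rw [map_zero] at h1
    obtain ⟨B, hB⟩ := (hk.image f.continuous).bddAbove
    have hB' : ∀ a ∈ P, f a ≤ B := fun a ha => hB ⟨a, ha, rfl⟩
    have hBp : 0 < |B| + 1 := by positivity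
    refine ⟨(|B| + 1)⁻¹ • (f.toLinearMap.comp (Submodule.subtype _)), fun a ha => ?_, ?_⟩
    · have := hB' a ha
      have h3 : f a ≤ |B| + 1 := by linarith [le_abs_self B]
      simpa using (inv_mul_le_one₀ hBp).2 h3
    · have : 0 < f m := by linarith
      simpa using mul_pos (inv_pos.2 hBp) this
  · have hn : t⁻¹ • m ∉ P := by
      intro h'
      refine ht ⟨h.le, _, h', ?_⟩
      rw [smul_smul, mul_inv_cancel₀ h.ne', one_smul]
    obtain ⟨f, u, hf, hu⟩ := geometric_hahn_banach_closed_point hc hk.isClosed hn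
    have hu0 : 0 < u := by simpa using hf 0 h0
    refine ⟨u⁻¹ • (f.toLinearMap.comp (Submodule.subtype _)), fun a ha => ?_, ?_⟩
    · simpa using (inv_mul_le_one₀ hu0).2 (hf a ha).le
    · have h3 : u < t⁻¹ * f m := by simpa using hu
      have h4 : t * u < f m := by
        have := mul_lt_mul_of_pos_left h3 h
        rwa [← mul_assoc, mul_inv_cancel₀ h.ne', one_mul] at this
      have : t < u⁻¹ * f m := by
        rw [inv_mul_eq_div, lt_div_iff₀ hu0]; exact h4
      simpa using this

/-- The lower envelope, characterized. -/
lemma mem_lenv_iff {n : ℕ} {P : Set (Fin n → ℝ)} (hc : Convex ℝ P) (hk : IsCompact P)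
    (h0 : (0 : Fin n → ℝ) ∈ P) (x : Fin (n + 1) → ℝ) :
    x ∈ lenv P ↔ x ∈ cone P ∧ ∀ l : ℝ, 0 < l → x - l • eLast n ∉ cone P := by
  constructor
  · rintro ⟨z, hz, rfl⟩
    set S : Set ℝ := {l : ℝ | z - l • eLast n ∈ cone P} with hS
    have hbdd : BddAbove S := ⟨z (Fin.last n), fun l hl => by
      have := ((sub_mem_cone_iff P z l).1 hl).1
      linarith⟩
    have hne : S.Nonempty := ⟨0, by simpa [hS] using hz⟩
    have hsp := CC_mem_span ((mem_cone_iff P z).1 hz)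
    have hmem : sSup S ∈ S := by
      by_contra hcon
      have hcon' : ¬ CC P (fun j => z j.castSucc) (z (Fin.last n) - sSup S) := fun h =>
        hcon ((sub_mem_cone_iff P z _).2 h)
      obtain ⟨φ, hφ, hlt⟩ := sep hc hk h0 hcon' hsp
      have : sSup S ≤ z (Fin.last n) - φ ⟨_, hsp⟩ := by
        refine csSup_le hne fun l hl => ?_
        have := CC_le ((sub_mem_cone_iff P z l).1 hl) hφ hsp
        linarith
      linarith
    refine ⟨hmem, fun l hl hx => ?_⟩
    have : sSup S + l ∈ S := by
      have e : z - (sSup S + l) • eLast n = eps P z - l • eLast n := by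
        rw [eps, add_smul, sub_sub]
      rw [hS, mem_setOf_eq, e]
      exact hx
    have := le_csSup hbdd this
    linarith
  · rintro ⟨hx, hl⟩
    refine ⟨x, hx, ?_⟩
    have : IsGreatest {l : ℝ | x - l • eLast n ∈ cone P} 0 := by
      refine ⟨by simpa using hx, fun l h => ?_⟩
      by_contra hcon
      exact hl l (not_le.1 hcon) h
    rw [eps, this.csSup_eq]
    simp

lemma mem_dualSet_iff {n : ℕ} {P : Set (Fin n → ℝ)} {V : Finset (Fin n → ℝ)}
    (hV : P = convexHull ℝ (V : Set (Fin n → ℝ))) (hVs : ∀ v ∈ V, v ∈ Submodule.span ℝ P)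
    (φ : Module.Dual ℝ (Submodule.span ℝ P)) :
    φ ∈ dualSet P ↔ ∀ v (hv : v ∈ V), φ ⟨v, hVs v hv⟩ ≤ 1 := by
  constructor
  · intro h v hv
    refine h _ ?_
    show v ∈ P
    rw [hV]
    exact subset_convexHull _ _ hv
  · intro h a ha
    obtain ⟨Φ, hΦ⟩ := LinearMap.exists_extend φ
    have hΦ' : ∀ b : Submodule.span ℝ P, φ b = Φ b := fun b => by rw [← hΦ]; rfl
    rw [hΦ']
    have hsub : P ⊆ {x | Φ x ≤ 1} := by
      rw [hV]
      refine convexHull_min (fun v hv => ?_) (convex_halfSpace_le Φ.isLinear 1)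
      have := h v hv
      rw [hΦ'] at this
      exact this
    exact hsub ha

lemma ext_on_V {n : ℕ} {P : Set (Fin n → ℝ)} {V : Finset (Fin n → ℝ)}
    (hV : P = convexHull ℝ (V : Set (Fin n → ℝ))) (hVs : ∀ v ∈ V, v ∈ Submodule.span ℝ P)
    (χ : Module.Dual ℝ (Submodule.span ℝ P))
    (h : ∀ v (hv : v ∈ V), χ ⟨v, hVs v hv⟩ = 0) : χ = 0 := by
  obtain ⟨Φ, hΦ⟩ := LinearMap.exists_extend χ
  have hΦ' : ∀ b : Submodule.span ℝ P, χ b = Φ b := fun b => by rw [← hΦ]; rfl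
  have hle : Submodule.span ℝ P ≤ LinearMap.ker Φ := by
    rw [Submodule.span_le, hV]
    refine convexHull_min (fun v hv => ?_) (LinearMap.ker Φ).convex
    have := h v hv
    rw [hΦ'] at this
    exact this
  ext b
  rw [hΦ']
  exact hle b.2

/-- At an extreme point the active constraints determine everything. -/
lemma extreme_rigid {n : ℕ} {P : Set (Fin n → ℝ)} {V : Finset (Fin n → ℝ)}
    (hV : P = convexHull ℝ (V : Set (Fin n → ℝ))) (hVs : ∀ v ∈ V, v ∈ Submodule.span ℝ P)
    {φ : Module.Dual ℝ (Submodule.span ℝ P)} (hφ : φ ∈ Set.extremePoints ℝ (dualSet P))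
    (χ : Module.Dual ℝ (Submodule.span ℝ P))
    (h : ∀ v (hv : v ∈ V), φ ⟨v, hVs v hv⟩ = 1 → χ ⟨v, hVs v hv⟩ = 0) : χ = 0 := by
  have hmem := (mem_dualSet_iff hV hVs φ).1 hφ.1
  -- a uniform small step
  have hδ : ∃ δ : ℝ, 0 < δ ∧ ∀ v (hv : v ∈ V), δ * |χ ⟨v, hVs v hv⟩| ≤ 1 - φ ⟨v, hVs v hv⟩ := by
    have key : ∀ᶠ δ : ℝ in nhdsWithin 0 (Ioi 0), ∀ v : V,
        δ * |χ ⟨v.1, hVs v.1 v.2⟩| ≤ 1 - φ ⟨v.1, hVs v.1 v.2⟩ := by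
      rw [Filter.eventually_all]
      rintro ⟨v, hv⟩
      rcases eq_or_lt_of_le (hmem v hv) with h1 | h1
      · refine Filter.Eventually.of_forall fun δ => ?_
        simp only [h v hv h1, h1]
        simp
      · have ht : Filter.Tendsto (fun δ : ℝ => δ * |χ ⟨v, hVs v hv⟩|) (nhdsWithin 0 (Ioi 0))
            (nhds (0 * |χ ⟨v, hVs v hv⟩|)) :=
          ((continuous_id.mul continuous_const).tendsto 0).mono_left nhdsWithin_le_nhds
        rw [zero_mul] at ht
        filter_upwards [ht.eventually (gt_mem_nhds (sub_pos.2 h1))] with δ hδ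
        exact hδ.le
    obtain ⟨δ, h1, h2⟩ := (key.and self_mem_nhdsWithin).exists
    exact ⟨δ, h2, fun v hv => h1 ⟨v, hv⟩⟩
  obtain ⟨δ, hδ0, hδ⟩ := hδ
  have m1 : φ + δ • χ ∈ dualSet P := by
    rw [mem_dualSet_iff hV hVs]
    intro v hv
    have := hδ v hv
    have h2 := mul_le_mul_of_nonneg_left (le_abs_self (χ ⟨v, hVs v hv⟩)) hδ0.le
    simp only [LinearMap.add_apply, LinearMap.smul_apply, smul_eq_mul]
    linarith
  have m2 : φ - δ • χ ∈ dualSet P := by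
    rw [mem_dualSet_iff hV hVs]
    intro v hv
    have := hδ v hv
    have h2 := mul_le_mul_of_nonneg_left (neg_abs_le (χ ⟨v, hVs v hv⟩)) hδ0.le
    simp only [LinearMap.sub_apply, LinearMap.smul_apply, smul_eq_mul]
    linarith
  have hseg : φ ∈ openSegment ℝ (φ + δ • χ) (φ - δ • χ) := by
    refine ⟨1/2, 1/2, by norm_num, by norm_num, by norm_num, ?_⟩
    module
  have := hφ.2 m1 m2 hseg
  have h3 : δ • χ = 0 := by simpa using this
  exact (smul_eq_zero.1 h3).resolve_left hδ0.ne'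

lemma extreme_of_rigid {n : ℕ} {P : Set (Fin n → ℝ)} {V : Finset (Fin n → ℝ)}
    (hV : P = convexHull ℝ (V : Set (Fin n → ℝ))) (hVs : ∀ v ∈ V, v ∈ Submodule.span ℝ P)
    {φ : Module.Dual ℝ (Submodule.span ℝ P)} (hφ : φ ∈ dualSet P)
    (h : ∀ χ : Module.Dual ℝ (Submodule.span ℝ P),
      (∀ v (hv : v ∈ V), φ ⟨v, hVs v hv⟩ = 1 → χ ⟨v, hVs v hv⟩ = 0) → χ = 0) :
    φ ∈ Set.extremePoints ℝ (dualSet P) := by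
  refine ⟨hφ, ?_⟩
  rintro φ₁ h₁ φ₂ h₂ ⟨a, b, ha, hb, hab, rfl⟩
  rw [mem_dualSet_iff hV hVs] at h₁ h₂
  have : φ₁ - (a • φ₁ + b • φ₂) = 0 := by
    refine h _ fun v hv hv1 => ?_
    have e1 := h₁ v hv
    have e2 := h₂ v hv
    simp only [LinearMap.add_apply, LinearMap.sub_apply, LinearMap.smul_apply,
      smul_eq_mul] at hv1 ⊢
    rw [hv1]
    nlinarith
  exact sub_eq_zero.1 this

open Finset in
/-- Every dual point can be improved to an extreme one. -/
lemma exists_extreme {n : ℕ} {P : Set (Fin n → ℝ)} {V : Finset (Fin n → ℝ)}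
    (hV : P = convexHull ℝ (V : Set (Fin n → ℝ))) (hVs : ∀ v ∈ V, v ∈ Submodule.span ℝ P)
    {m : Fin n → ℝ} {s : ℝ} (hC : CC P m s) (hm : m ∈ Submodule.span ℝ P) :
    ∀ (k : ℕ) (φ : Module.Dual ℝ (Submodule.span ℝ P)), φ ∈ dualSet P →
      (V.attach.filter (fun v => ¬ φ ⟨v.1, hVs v.1 v.2⟩ = 1)).card ≤ k →
      ∃ ψ ∈ Set.extremePoints ℝ (dualSet P), φ ⟨m, hm⟩ ≤ ψ ⟨m, hm⟩ := by
  intro k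
  induction k with
  | zero =>
    intro φ hφ hcard
    refine ⟨φ, extreme_of_rigid hV hVs hφ fun χ hχ => ext_on_V hV hVs χ fun v hv => ?_, le_rfl⟩
    refine hχ v hv ?_
    by_contra hne
    rw [Nat.le_zero, Finset.card_eq_zero] at hcard
    have : (⟨v, hv⟩ : {x // x ∈ V}) ∈ (∅ : Finset {x // x ∈ V}) := by
      rw [← hcard]; simp [hne]
    simp at this
  | succ k ih =>
    intro φ hφ hcard
    by_cases hr : ∀ χ : Module.Dual ℝ (Submodule.span ℝ P),
      (∀ v (hv : v ∈ V), φ ⟨v, hVs v hv⟩ = 1 → χ ⟨v, hVs v hv⟩ = 0) → χ = 0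
    · exact ⟨φ, extreme_of_rigid hV hVs hφ hr, le_rfl⟩
    push Not at hr
    obtain ⟨χ, hχ, hχ0⟩ := hr
    -- choose a good direction
    have hdir : ∃ χ : Module.Dual ℝ (Submodule.span ℝ P),
        (∀ v (hv : v ∈ V), φ ⟨v, hVs v hv⟩ = 1 → χ ⟨v, hVs v hv⟩ = 0) ∧ 0 ≤ χ ⟨m, hm⟩ ∧
        ∃ v, ∃ hv : v ∈ V, 0 < χ ⟨v, hVs v hv⟩ := by
      have hcone : ∀ χ : Module.Dual ℝ (Submodule.span ℝ P),
          (∀ v (hv : v ∈ V), χ ⟨v, hVs v hv⟩ ≤ 0) → χ ⟨m, hm⟩ ≤ 0 := by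
        intro χ h
        have hN : ∀ N : ℕ, (N : ℝ) * χ ⟨m, hm⟩ ≤ s := by
          intro N
          have : (N : ℝ) • χ ∈ dualSet P := by
            rw [mem_dualSet_iff hV hVs]
            intro v hv
            have := h v hv
            have h2 : (0 : ℝ) ≤ N := Nat.cast_nonneg N
            simp only [LinearMap.smul_apply, smul_eq_mul]
            nlinarith
          simpa using CC_le hC this hm
        by_contra hcon
        push Not at hcon
        obtain ⟨N, hN'⟩ := exists_nat_gt (s / χ ⟨m, hm⟩)
        rw [div_lt_iff₀ hcon] at hN'
        linarith [hN N]
      have hone : ∀ χ : Module.Dual ℝ (Submodule.span ℝ P), χ ≠ 0 →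
          (∀ v (hv : v ∈ V), φ ⟨v, hVs v hv⟩ = 1 → χ ⟨v, hVs v hv⟩ = 0) → 0 ≤ χ ⟨m, hm⟩ →
          ∃ χ : Module.Dual ℝ (Submodule.span ℝ P),
            (∀ v (hv : v ∈ V), φ ⟨v, hVs v hv⟩ = 1 → χ ⟨v, hVs v hv⟩ = 0) ∧ 0 ≤ χ ⟨m, hm⟩ ∧
            ∃ v, ∃ hv : v ∈ V, 0 < χ ⟨v, hVs v hv⟩ := by
        intro χ hne hχ hpos
        by_cases hex : ∃ v, ∃ hv : v ∈ V, 0 < χ ⟨v, hVs v hv⟩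
        · exact ⟨χ, hχ, hpos, hex⟩
        push Not at hex
        have hz := hcone χ hex
        refine ⟨-χ, fun v hv h1 => by simp [hχ v hv h1], by simpa using hz, ?_⟩
        by_contra hno
        push Not at hno
        refine hne (ext_on_V hV hVs χ fun v hv => le_antisymm (hex v hv) ?_)
        have := hno v hv
        simpa using this
      rcases le_total 0 (χ ⟨m, hm⟩) with h | h
      · exact hone χ hχ0 hχ h
      · exact hone (-χ) (neg_ne_zero.2 hχ0) (fun v hv h1 => by simp [hχ v hv h1])
          (by simpa using h)
    obtain ⟨χ, hχ, hχm, v₀, hv₀, hpos₀⟩ := hdir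
    have hmem := (mem_dualSet_iff hV hVs φ).1 hφ
    let T := V.attach.filter (fun v => 0 < χ ⟨v.1, hVs v.1 v.2⟩)
    have hT : T.Nonempty := ⟨⟨v₀, hv₀⟩, by simp [T, hpos₀]⟩
    obtain ⟨⟨w, hw⟩, hwT, hmin⟩ := Finset.exists_min_image T
      (fun v => (1 - φ ⟨v.1, hVs v.1 v.2⟩) / χ ⟨v.1, hVs v.1 v.2⟩) hT
    have hwpos : 0 < χ ⟨w, hVs w hw⟩ := (Finset.mem_filter.1 hwT).2
    set t : ℝ := (1 - φ ⟨w, hVs w hw⟩) / χ ⟨w, hVs w hw⟩ with ht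
    have ht0 : 0 ≤ t := div_nonneg (by linarith [hmem w hw]) hwpos.le
    have hnew : φ + t • χ ∈ dualSet P := by
      rw [mem_dualSet_iff hV hVs]
      intro v hv
      simp only [LinearMap.add_apply, LinearMap.smul_apply, smul_eq_mul]
      by_cases hp : 0 < χ ⟨v, hVs v hv⟩
      · have := hmin ⟨v, hv⟩ (by simp [T, hp])
        have h2 : t ≤ (1 - φ ⟨v, hVs v hv⟩) / χ ⟨v, hVs v hv⟩ := this
        rw [le_div_iff₀ hp] at h2
        linarith
      · have := hmem v hv
        nlinarith
    have hcard' : (V.attach.filter (fun v => ¬ (φ + t • χ) ⟨v.1, hVs v.1 v.2⟩ = 1)).card ≤ k := by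
      have hlt : (V.attach.filter (fun v => ¬ (φ + t • χ) ⟨v.1, hVs v.1 v.2⟩ = 1)).card <
          (V.attach.filter (fun v => ¬ φ ⟨v.1, hVs v.1 v.2⟩ = 1)).card := by
        refine Finset.card_lt_card ?_
        rw [Finset.ssubset_iff_of_subset]
        · refine ⟨⟨w, hw⟩, ?_, ?_⟩
          · simp only [Finset.mem_filter, Finset.mem_attach, true_and]
            intro h1
            exact hwpos.ne' (hχ w hw h1)
          · simp only [Finset.mem_filter, Finset.mem_attach, true_and, not_not,
              LinearMap.add_apply, LinearMap.smul_apply, smul_eq_mul]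
            rw [ht, div_mul_cancel₀ _ hwpos.ne']
            ring
        · rintro ⟨v, hv⟩
          simp only [Finset.mem_filter, Finset.mem_attach, true_and]
          intro h1 h2
          apply h1
          simp [h2, hχ v hv h2]
      omega
    obtain ⟨ψ, hψ, hle⟩ := ih _ hnew hcard'
    refine ⟨ψ, hψ, le_trans ?_ hle⟩
    simp only [LinearMap.add_apply, LinearMap.smul_apply, smul_eq_mul]
    have := mul_nonneg ht0 hχm
    linarith

/-- Each extreme point has a denominator. -/
lemma extreme_den {n : ℕ} {P : Set (Fin n → ℝ)} {V : Finset (Fin n → ℝ)}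
    (hV : P = convexHull ℝ (V : Set (Fin n → ℝ))) (hVs : ∀ v ∈ V, v ∈ Submodule.span ℝ P)
    (hq : ∀ v ∈ V, ∀ i, ∃ q : ℚ, v i = (q : ℝ))
    {φ : Module.Dual ℝ (Submodule.span ℝ P)} (hφ : φ ∈ Set.extremePoints ℝ (dualSet P)) :
    ∃ d : ℕ, 0 < d ∧ IsDualLatticePt P ((d : ℝ) • φ) := by
  obtain ⟨Φ, hΦ⟩ := LinearMap.exists_extend φ
  have hΦ' : ∀ b : Submodule.span ℝ P, φ b = Φ b := fun b => by rw [← hΦ]; rfl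
  -- a ℚ-linear projection ℝ → ℚ
  obtain ⟨π, hπ⟩ := LinearMap.exists_leftInverse_of_injective
    (Algebra.linearMap ℚ ℝ) (LinearMap.ker_eq_bot.2 (algebraMap ℚ ℝ).injective)
  have hπ1 : ∀ q : ℚ, π (q : ℝ) = q := fun q => by
    have := LinearMap.congr_fun hπ q
    simpa using this
  let c : Fin n → ℚ := fun j => π (Φ (Pi.single j 1))
  have hsum : ∀ x : Fin n → ℝ, Φ x = ∑ j, x j * Φ (Pi.single j 1) := fun x => by
    rw [LinearMap.pi_apply_eq_sum_univ Φ x]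
    refine Finset.sum_congr rfl fun j _ => ?_
    rw [smul_eq_mul]
    congr 2
    ext i
    simp [Pi.single_apply, eq_comm]
  let Ψ : (Fin n → ℝ) →ₗ[ℝ] ℝ := ∑ j, (c j : ℝ) • LinearMap.proj j
  have hΨ : ∀ x, Ψ x = ∑ j, (c j : ℝ) * x j := fun x => by simp [Ψ]
  have heq : φ - Ψ.comp (Submodule.subtype _) = 0 := by
    refine extreme_rigid hV hVs hφ _ fun v hv h1 => ?_
    choose q hqv using hq v hv
    rw [hΦ', hsum] at h1
    have h2 : ∑ j, q j * c j = 1 := by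
      have h3 := congrArg π h1
      rw [map_sum] at h3
      have h4 : π 1 = 1 := by simpa using hπ1 1
      rw [h4] at h3
      rw [← h3]
      refine Finset.sum_congr rfl fun j _ => ?_
      show q j * c j = π (v j * _)
      rw [hqv j, ← Rat.smul_def, map_smul, smul_eq_mul]
    have h5 : Ψ v = 1 := by
      rw [hΨ]
      have : (∑ j, (q j : ℝ) * (c j : ℝ)) = 1 := by exact_mod_cast h2
      rw [← this]
      refine Finset.sum_congr rfl fun j _ => ?_
      rw [hqv j, mul_comm]
    have h6 : φ ⟨v, hVs v hv⟩ = 1 := by rw [hΦ', hsum]; exact h1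
    simp [h5, h6]
  refine ⟨∏ j, (c j).den, Finset.prod_pos fun j _ => (c j).pos, ?_⟩
  intro a ha
  choose z hz using ha
  have h7 : φ a = Ψ a := by
    rw [sub_eq_zero.1 heq]; rfl
  have hint : ∀ j, ∃ w : ℤ, ((∏ j, (c j).den : ℕ) : ℝ) * (c j : ℝ) = (w : ℝ) := by
    intro j
    obtain ⟨e, he⟩ := Finset.dvd_prod_of_mem (fun j => (c j).den) (Finset.mem_univ j)
    refine ⟨(c j).num * e, ?_⟩
    rw [he]
    have h8 : ((c j).den : ℝ) * (c j : ℝ) = ((c j).num : ℝ) := by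
      exact_mod_cast Rat.den_mul_eq_num (c j)
    push_cast
    rw [← h8]
    ring
  choose w hw using hint
  refine ⟨∑ j, w j * z j, ?_⟩
  rw [LinearMap.smul_apply, smul_eq_mul, h7, hΨ, Finset.mul_sum]
  push_cast
  refine Finset.sum_congr rfl fun j _ => ?_
  rw [← mul_assoc, ← hw j, ← hz j]
  push_cast
  rfl

lemma extreme_finite {n : ℕ} {P : Set (Fin n → ℝ)} {V : Finset (Fin n → ℝ)}
    (hV : P = convexHull ℝ (V : Set (Fin n → ℝ))) (hVs : ∀ v ∈ V, v ∈ Submodule.span ℝ P) :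
    (Set.extremePoints ℝ (dualSet P)).Finite := by
  let F : Module.Dual ℝ (Submodule.span ℝ P) → Finset {x // x ∈ V} := fun φ =>
    V.attach.filter (fun v => φ ⟨v.1, hVs v.1 v.2⟩ = 1)
  refine Set.Finite.of_finite_image (f := F) (Set.toFinite _) ?_
  intro φ hφ ψ hψ h
  rw [← sub_eq_zero]
  refine extreme_rigid hV hVs hφ _ fun v hv h1 => ?_
  have h2 : (⟨v, hv⟩ : {x // x ∈ V}) ∈ F φ := by simp [F, h1]
  rw [h] at h2
  have h3 := (Finset.mem_filter.1 h2).2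
  simp only at h3
  rw [LinearMap.sub_apply, h1, h3, sub_self]

lemma dualDen_spec {n : ℕ} {P : Set (Fin n → ℝ)} {V : Finset (Fin n → ℝ)}
    (hV : P = convexHull ℝ (V : Set (Fin n → ℝ))) (hVs : ∀ v ∈ V, v ∈ Submodule.span ℝ P)
    (hq : ∀ v ∈ V, ∀ i, ∃ q : ℚ, v i = (q : ℝ)) :
    0 < dualDen P ∧ ∀ φ ∈ Set.extremePoints ℝ (dualSet P),
      IsDualLatticePt P ((dualDen P : ℝ) • φ) := by
  have hne : {d : ℕ | 0 < d ∧ ∀ φ ∈ Set.extremePoints ℝ (dualSet P),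
      IsDualLatticePt P ((d : ℝ) • φ)}.Nonempty := by
    have hd : ∀ φ : Module.Dual ℝ (Submodule.span ℝ P), ∃ d : ℕ, 0 < d ∧
        (φ ∈ Set.extremePoints ℝ (dualSet P) → IsDualLatticePt P ((d : ℝ) • φ)) := by
      intro φ
      by_cases h : φ ∈ Set.extremePoints ℝ (dualSet P)
      · obtain ⟨d, h1, h2⟩ := extreme_den hV hVs hq h
        exact ⟨d, h1, fun _ => h2⟩
      · exact ⟨1, one_pos, fun h' => absurd h' h⟩
    choose D hD0 hD using hd
    have hf := extreme_finite hV hVs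
    refine ⟨∏ φ ∈ hf.toFinset, D φ, Finset.prod_pos fun φ _ => hD0 φ, fun φ hφ a ha => ?_⟩
    obtain ⟨e, he⟩ := Finset.dvd_prod_of_mem D (hf.mem_toFinset.2 hφ)
    obtain ⟨z, hz⟩ := hD φ hφ a ha
    refine ⟨e * z, ?_⟩
    rw [he]
    push_cast
    rw [← hz]
    simp only [LinearMap.smul_apply, smul_eq_mul]
    ring
  exact Nat.sInf_mem hne

lemma mem_shift {n : ℕ} (S : Set (Fin (n + 1) → ℝ)) (c y : Fin (n + 1) → ℝ) :
    y ∈ (fun x => x + c) '' S ↔ y - c ∈ S := by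
  constructor
  · rintro ⟨x, hx, rfl⟩; simpa using hx
  · intro h; exact ⟨_, h, by simp⟩

/-- Proposition 4.1(b) (lattice points of a shifted lower envelope as a
set difference of shifted cones). -/
theorem shifted_lenv_lattice_eq {n : ℕ} (hn : 1 ≤ n) (P : Set (Fin n → ℝ))
    (hP : IsRatPolytope P) (hP0 : (0 : Fin n → ℝ) ∈ P) :
    ∀ i : ℕ, i ≤ dualDen P - 1 →
      latt ((fun x => x + ((i : ℝ) / (dualDen P : ℝ)) • eLast n) '' lenv P) =
        latt ((fun x => x + ((i : ℝ) / (dualDen P : ℝ)) • eLast n) '' cone P) \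
          latt ((fun x => x + (((i : ℝ) + 1) / (dualDen P : ℝ)) • eLast n) '' cone P) := by
  obtain ⟨V, hq, hV⟩ := hP
  have hVs : ∀ v ∈ V, v ∈ Submodule.span ℝ P := fun v hv =>
    Submodule.subset_span (by rw [hV]; exact subset_convexHull _ _ hv)
  have hc : Convex ℝ P := by rw [hV]; exact convex_convexHull ℝ _
  have hk : IsCompact P := by rw [hV]; exact V.finite_toSet.isCompact_convexHull ℝ
  obtain ⟨hd, hden⟩ := dualDen_spec hV hVs hq
  intro i _
  generalize dualDen P = d at hd hden ⊢
  have hd' : (0 : ℝ) < d := by exact_mod_cast hd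
  ext y
  simp only [latt, mem_diff, mem_setOf_eq, mem_shift, mem_lenv_iff hc hk hP0]
  have hsplit : y - (((i : ℝ) + 1) / d) • eLast n =
      y - ((i : ℝ) / d) • eLast n - (1 / (d : ℝ)) • eLast n := by
    rw [sub_sub, ← add_smul, ← add_div]
  constructor
  · rintro ⟨⟨h1, h2⟩, hy⟩
    refine ⟨⟨h1, hy⟩, fun h => h2 (1 / d) (by positivity) ?_⟩
    rw [← hsplit]
    exact h.1
  · rintro ⟨⟨h1, hy⟩, h2⟩
    refine ⟨⟨h1, fun l hl hcon => ?_⟩, hy⟩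
    have h3 : ¬ CC P (fun j => y j.castSucc) (y (Fin.last n) - ((i : ℝ) + 1) / d) := fun h =>
      h2 ⟨(sub_mem_cone_iff P y _).2 h, hy⟩
    have h1' := (sub_mem_cone_iff P y _).1 h1
    rw [sub_sub, ← add_smul, sub_mem_cone_iff] at hcon
    have hsp := CC_mem_span h1'
    obtain ⟨φ, hφ, hlt⟩ := sep hc hk hP0 h3 hsp
    obtain ⟨ψ, hψ, hle⟩ := exists_extreme hV hVs h1' hsp _ φ hφ le_rfl
    have h4 := CC_le hcon hψ.1 hsp
    obtain ⟨z, hz⟩ := hden ψ hψ ⟨_, hsp⟩ (fun j => hy j.castSucc)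
    obtain ⟨w, hw⟩ := hy (Fin.last n)
    rw [LinearMap.smul_apply, smul_eq_mul] at hz
    rw [hw] at h4 hlt
    have h5 : (w : ℝ) - (i + 1) / d < ψ ⟨_, hsp⟩ := lt_of_lt_of_le hlt hle
    have h6 : (d : ℝ) * w - (i + 1) < z := by
      rw [← hz]
      have := mul_lt_mul_of_pos_left h5 hd'
      rw [mul_sub, mul_div_cancel₀ _ hd'.ne'] at this
      exact this
    have h7 : (z : ℝ) < d * w - i := by
      rw [← hz]
      have h8 : ψ ⟨_, hsp⟩ < (w : ℝ) - i / d := by linarith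
      have := mul_lt_mul_of_pos_left h8 hd'
      rw [mul_sub, mul_div_cancel₀ _ hd'.ne'] at this
      exact this
    have h6' : (d : ℤ) * w - (i + 1) < z := by exact_mod_cast h6
    have h7' : z < (d : ℤ) * w - i := by exact_mod_cast h7
    omega

end ArxivFreeSum
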